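/- arXiv:1211.5996 — 3 statements merged into one kernel-verified Lean document; each statement's English description precedes it below -/
import Mathlib

section
/- For every real number x that is not a nonpositive integer, sgn(x) ≤ B(x), where B is the Beurling function; that is, B is a majorant of the sign function on the real line. -/
open Real

/-- The Beurling function `B(x) = 1 + 2 (sin(πx)/π)^2 (1/x − Σ_{n=1}^∞ 1/(n+x)^2)`,
defined (by this formula) for `x` not a nonpositive integer. -/
noncomputable def beurlingB (x : ℝ) : ℝ :=
  1 + 2 * (Real.sin (Real.pi * x) / Real.pi) ^ 2 *
    (1 / x - ∑' n : ℕ, 1 / (((n : ℝ) + 1) + x) ^ 2)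

theorem sum_range_two_mul (g : ℕ → ℝ) (n : ℕ) :
    ∑ j ∈ Finset.range (2 * n), g j = ∑ j ∈ Finset.range n, (g (2 * j) + g (2 * j + 1)) := by
  induction n with
  | zero => simp
  | succ n ih =>
    rw [show 2 * (n + 1) = 2 * n + 1 + 1 by ring, Finset.sum_range_succ, Finset.sum_range_succ,
      Finset.sum_range_succ, ih]
    ring

/-- Duplication formula for the squared cosecant. -/
theorem sq_div_sin_duplication (x : ℝ) (h : Real.sin (Real.pi * x) ≠ 0) :
    Real.sin (Real.pi * (x / 2)) ≠ 0 ∧ Real.sin (Real.pi * ((x + 1) / 2)) ≠ 0 ∧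
    (Real.pi / Real.sin (Real.pi * x)) ^ 2 =
      ((Real.pi / Real.sin (Real.pi * (x / 2))) ^ 2 +
        (Real.pi / Real.sin (Real.pi * ((x + 1) / 2))) ^ 2) / 4 := by
  have h1 : Real.sin (Real.pi * ((x + 1) / 2)) = Real.cos (Real.pi * (x / 2)) := by
    rw [← Real.sin_add_pi_div_two]
    congr 1
    ring
  have h2 : Real.sin (Real.pi * x) =
      2 * Real.sin (Real.pi * (x / 2)) * Real.cos (Real.pi * (x / 2)) := by
    rw [← Real.sin_two_mul]
    congr 1
    ring
  rw [h1]
  have hs : Real.sin (Real.pi * (x / 2)) ≠ 0 := by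
    intro h0
    simp [h2, h0] at h
  have hc : Real.cos (Real.pi * (x / 2)) ≠ 0 := by
    intro h0
    simp [h2, h0] at h
  refine ⟨hs, hc, ?_⟩
  rw [h2]
  have hsq := Real.sin_sq_add_cos_sq (Real.pi * (x / 2))
  generalize Real.sin (Real.pi * (x / 2)) = s at *
  generalize Real.cos (Real.pi * (x / 2)) = c at *
  field_simp
  linear_combination (-4 : ℝ) * hsq

/-- Partial sums of the cosecant series are bounded by the squared cosecant. -/
theorem sum_range_two_pow_le_sq_div_sin (k : ℕ) : ∀ x : ℝ, Real.sin (Real.pi * x) ≠ 0 →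
    ∑ j ∈ Finset.range (2 ^ k), 1 / (x + j) ^ 2 ≤ (Real.pi / Real.sin (Real.pi * x)) ^ 2 := by
  induction k with
  | zero =>
    intro x h
    have hx : x ≠ 0 := by
      rintro rfl
      simp at h
    have hle : Real.sin (Real.pi * x) ^ 2 ≤ (Real.pi * x) ^ 2 := by
      rw [sq_le_sq]
      exact Real.abs_sin_le_abs
    simp only [pow_zero, Finset.range_one, Finset.sum_singleton, Nat.cast_zero, add_zero]
    rw [div_pow, div_le_div_iff₀ (by positivity) (by positivity)]
    linarith [mul_pow Real.pi x 2]
  | succ k ih =>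
    intro x h
    obtain ⟨hs, hc, heq⟩ := sq_div_sin_duplication x h
    have e1 := ih _ hs
    have e2 := ih _ hc
    have key : ∑ j ∈ Finset.range (2 ^ (k + 1)), 1 / (x + j) ^ 2 =
        (∑ j ∈ Finset.range (2 ^ k), 1 / (x / 2 + j) ^ 2 +
          ∑ j ∈ Finset.range (2 ^ k), 1 / ((x + 1) / 2 + j) ^ 2) / 4 := by
      rw [pow_succ', sum_range_two_mul, ← Finset.sum_add_distrib, Finset.sum_div]
      refine Finset.sum_congr rfl fun j _ => ?_
      push_cast
      rw [show x / 2 + (j : ℝ) = (x + 2 * j) / 2 by ring,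
        show (x + 1) / 2 + (j : ℝ) = (x + (2 * j + 1)) / 2 by ring, div_pow, div_pow,
        one_div_div, one_div_div]
      ring
    rw [key, heq]
    linarith

/-- Symmetric partial sums of the cosecant series are bounded by the squared cosecant. -/
theorem sum_add_sum_le_sq_div_sin (x : ℝ) (h : Real.sin (Real.pi * x) ≠ 0) (N : ℕ) :
    ∑ j ∈ Finset.range N, 1 / (((j : ℝ) + 1) + x) ^ 2 +
      ∑ j ∈ Finset.range N, 1 / (-x + j) ^ 2 ≤ (Real.pi / Real.sin (Real.pi * x)) ^ 2 := by
  cases N with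
  | zero => simpa using sq_nonneg _
  | succ M =>
    have hshift : Real.sin (Real.pi * (x - M)) = (-1) ^ M * Real.sin (Real.pi * x) := by
      rw [← Real.sin_sub_nat_mul_pi]
      congr 1
      ring
    have hsq : (Real.pi / Real.sin (Real.pi * (x - M))) ^ 2 =
        (Real.pi / Real.sin (Real.pi * x)) ^ 2 := by
      rw [hshift, div_pow, div_pow, mul_pow, ← pow_mul, mul_comm M 2, pow_mul]
      simp
    have hb := sum_range_two_pow_le_sq_div_sin (M + 2) (x - M)
      (by rw [hshift]; exact mul_ne_zero (by simp) h)
    rw [hsq] at hb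
    refine le_trans ?_ hb
    have hlt : M + 1 + (M + 1) ≤ 2 ^ (M + 2) := by
      have := (M + 1).lt_two_pow_self
      rw [pow_succ]
      omega
    refine le_trans (le_of_eq ?_) (Finset.sum_le_sum_of_subset_of_nonneg
      (Finset.range_mono hlt) fun _ _ _ => by positivity)
    rw [Finset.sum_range_add _ (M + 1) (M + 1), add_comm]
    congr 1
    · rw [← Finset.sum_range_reflect]
      refine Finset.sum_congr rfl fun j hj => ?_
      have hj' : j ≤ M := Nat.lt_succ_iff.mp (Finset.mem_range.mp hj)
      rw [show M + 1 - 1 - j = M - j by omega, Nat.cast_sub hj', ← neg_sq]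
      congr 2
      ring
    · refine Finset.sum_congr rfl fun j _ => ?_
      push_cast
      congr 2
      ring

theorem one_div_sub_le_sum_sq (y : ℝ) (hy : 0 < y) (N : ℕ) :
    1 / y - 1 / (y + N) ≤ ∑ j ∈ Finset.range N, 1 / (y + j) ^ 2 := by
  induction N with
  | zero => simp
  | succ N ih =>
    rw [Finset.sum_range_succ]
    have hp : 0 < y + N := by positivity
    have : 1 / (y + N) - 1 / (y + (N + 1 : ℕ)) ≤ 1 / (y + N) ^ 2 := by
      push_cast
      rw [← add_assoc, div_sub_div _ _ (by positivity) (by positivity),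
        div_le_div_iff₀ (by positivity) (by positivity)]
      nlinarith
    linarith

theorem sum_sq_le_one_div_sub (x : ℝ) (hx : 0 < x) (N : ℕ) :
    ∑ j ∈ Finset.range N, 1 / (((j : ℝ) + 1) + x) ^ 2 ≤ 1 / x - 1 / (x + N) := by
  induction N with
  | zero => simp
  | succ N ih =>
    rw [Finset.sum_range_succ]
    have hp : 0 < x + N := by positivity
    have : 1 / (((N : ℝ) + 1) + x) ^ 2 ≤ 1 / (x + N) - 1 / (x + (N + 1 : ℕ)) := by
      push_cast
      rw [show (N : ℝ) + 1 + x = x + N + 1 by ring, ← add_assoc,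
        div_sub_div _ _ (by positivity) (by positivity),
        div_le_div_iff₀ (by positivity) (by positivity)]
      nlinarith
    linarith

theorem tsum_add_one_div_le_sq_div_sin (x : ℝ) (hx : x < 0)
    (h : Real.sin (Real.pi * x) ≠ 0) :
    (∑' n : ℕ, 1 / (((n : ℝ) + 1) + x) ^ 2) + 1 / -x ≤
      (Real.pi / Real.sin (Real.pi * x)) ^ 2 := by
  have hbound := sum_add_sum_le_sq_div_sin x h
  have hsum : Summable fun n : ℕ => 1 / (((n : ℝ) + 1) + x) ^ 2 :=
    summable_of_sum_range_le (fun n => by positivity) fun N =>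
      le_trans (le_add_of_nonneg_right (Finset.sum_nonneg fun _ _ => by positivity)) (hbound N)
  have hlim : Filter.Tendsto (fun N : ℕ => 1 / (-x + (N : ℝ))) Filter.atTop (nhds 0) := by
    simp only [one_div]
    exact (Filter.tendsto_atTop_add_const_left _ _
      tendsto_natCast_atTop_atTop).inv_tendsto_atTop
  have ht := hsum.hasSum.tendsto_sum_nat.add (hlim.const_sub (1 / -x))
  rw [sub_zero] at ht
  refine le_of_tendsto' ht fun N => ?_
  linarith [hbound N, one_div_sub_le_sum_sq (-x) (neg_pos.mpr hx) N]

/-- for every real `x` that is not a nonpositive integer,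
`sgn(x) ≤ B(x)`; the Beurling function majorizes the sign function. -/
theorem beurling_majorizes_sgn (x : ℝ) (hx : ¬ ∃ m : ℕ, x = -(m : ℝ)) :
    Real.sign x ≤ beurlingB x := by
  unfold beurlingB
  rcases lt_trichotomy x 0 with h | h | h
  · rw [Real.sign_of_neg h]
    have hsin : Real.sin (Real.pi * x) ≠ 0 := by
      rw [Real.sin_ne_zero_iff]
      intro n hn
      have hxn : (n : ℝ) = x := by
        rw [mul_comm] at hn
        exact mul_left_cancel₀ Real.pi_ne_zero hn
      have hn0 : n < 0 := by
        rw [← hxn] at h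
        exact_mod_cast h
      refine hx ⟨(-n).toNat, ?_⟩
      have hc : (((-n).toNat : ℤ) : ℝ) = ((-n : ℤ) : ℝ) := by
        rw [Int.toNat_of_nonneg (by omega)]
      rw [Int.cast_natCast] at hc
      rw [hc, ← hxn]
      simp
    have hmain := tsum_add_one_div_le_sq_div_sin x h hsin
    have hmul := mul_le_mul_of_nonneg_left hmain
      (sq_nonneg (Real.sin (Real.pi * x) / Real.pi))
    have hone : (Real.sin (Real.pi * x) / Real.pi) ^ 2 *
        (Real.pi / Real.sin (Real.pi * x)) ^ 2 = 1 := by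
      field_simp
    rw [hone, one_div_neg_eq_neg_one_div] at hmul
    linarith
  · exact absurd ⟨0, by simpa using h⟩ hx
  · rw [Real.sign_of_pos h]
    have hle : ∑' n : ℕ, 1 / (((n : ℝ) + 1) + x) ^ 2 ≤ 1 / x :=
      Real.tsum_le_of_sum_range_le (fun n => by positivity) fun N =>
        (sum_sq_le_one_div_sub x h N).trans (sub_le_self _ (by positivity))
    exact le_add_of_nonneg_right (mul_nonneg (by positivity) (sub_nonneg.mpr hle))
end

section
/- The function x ↦ B(x) − sgn(x) (defined for real x that are not nonpositive integers, and extended by its limiting values at the nonpositive integers) is integrable on ℝ, and ∫_{−∞}^∞ (B(x) − sgn(x)) dx = 1. -/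
open Real MeasureTheory

/-- Parseval's identity for `t ↦ exp (2πixt)` on `[0, 1]`. -/
theorem hasSum_sq_sin_pi_mul_div_add_int {x : ℝ} (hx : ∀ n : ℤ, x ≠ n) :
    HasSum (fun n : ℤ => (sin (π * x) / π) ^ 2 / (x + n) ^ 2) 1 := by
  set f : ℝ → ℂ := fun t => Complex.exp (2 * π * x * Complex.I * t)
  have hfc : Continuous f := by fun_prop
  have hnorm (t : ℝ) : ‖f t‖ = 1 := by
    simp only [f]
    rw [show (2 * π * x * Complex.I * t : ℂ) = ((2 * π * x * t : ℝ) : ℂ) * Complex.I by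
      push_cast; ring, Complex.norm_exp_ofReal_mul_I]
  have hmem : MemLp f 2 (volume.restrict (Set.Ioc 0 1)) :=
    MemLp.of_bound hfc.aestronglyMeasurable 1 (.of_forall fun t => (hnorm t).le)
  have hcoef (n : ℤ) : ‖fourierCoeffOn zero_lt_one f n‖ ^ 2 =
      (sin (π * x) / π) ^ 2 / (x + (-n : ℤ)) ^ 2 := by
    have hxn : x - n ≠ 0 := sub_ne_zero.2 (hx n)
    have hc : (2 * π * (x - n) : ℝ) ≠ 0 := by positivity
    have hint : fourierCoeffOn zero_lt_one f n =
        ∫ t in (0 : ℝ)..1, Complex.exp (((2 * π * (x - n) : ℝ) * Complex.I) * t) := by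
      rw [fourierCoeffOn_eq_integral]
      simp only [sub_zero, div_one, one_smul]
      refine intervalIntegral.integral_congr fun t _ => ?_
      simp only [f, fourier_coe_apply, smul_eq_mul]
      rw [← Complex.exp_add]
      congr 1
      push_cast
      ring
    have hc' : ((2 * π * (x - n) : ℝ) * Complex.I : ℂ) ≠ 0 :=
      mul_ne_zero (by exact_mod_cast hc) Complex.I_ne_zero
    rw [hint, integral_exp_mul_complex hc']
    simp only [Complex.ofReal_one, mul_one, Complex.ofReal_zero, mul_zero, Complex.exp_zero]
    rw [norm_div, mul_comm _ Complex.I, Complex.norm_exp_I_mul_ofReal_sub_one, norm_mul Complex.I,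
      Complex.norm_I, one_mul, Complex.norm_real, div_pow, Real.norm_eq_abs, Real.norm_eq_abs,
      sq_abs, sq_abs, show 2 * π * (x - n) / 2 = π * x - n * π by ring, mul_pow,
      sin_sub_int_mul_pi, mul_pow]
    have hsq : ((-1 : ℝ) ^ n) ^ 2 = 1 := by
      rw [← zpow_natCast, ← zpow_mul, mul_comm, zpow_mul]; norm_num
    rw [hsq]
    push_cast
    rw [← sub_eq_add_neg]
    field_simp
  have hsum := hasSum_sq_fourierCoeffOn zero_lt_one hmem
  simp only [hcoef, hnorm] at hsum
  rw [← (Equiv.neg ℤ).hasSum_iff]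
  simpa [Function.comp_def] using hsum

theorem hasSum_one_div_sub_one_div_nat_add {x : ℝ} (hx : 0 < x) :
    HasSum (fun n : ℕ => 1 / (n + x) - 1 / (n + 1 + x)) (1 / x) := by
  rw [hasSum_iff_tendsto_nat_of_nonneg]
  · have h (n : ℕ) : ∑ i ∈ Finset.range n, (1 / ((i : ℝ) + x) - 1 / (i + 1 + x)) =
        1 / x - 1 / (n + x) := by
      have := Finset.sum_range_sub' (fun i : ℕ => 1 / ((i : ℝ) + x)) n
      simpa using this
    simp only [h]
    have : Filter.Tendsto (fun n : ℕ => 1 / ((n : ℝ) + x)) Filter.atTop (nhds 0) := by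
      simp only [one_div]
      exact (Filter.tendsto_atTop_add_const_right _ _
        tendsto_natCast_atTop_atTop).inv_tendsto_atTop
    simpa using this.const_sub (1 / x)
  · intro n
    rw [sub_nonneg]
    gcongr
    linarith

theorem one_div_sq_nat_add_one_add_le {x : ℝ} (hx : 0 < x) (n : ℕ) :
    1 / ((n : ℝ) + 1 + x) ^ 2 ≤ 1 / (n + x) - 1 / (n + 1 + x) := by
  rw [div_sub_div _ _ (by positivity) (by positivity)]
  rw [div_le_div_iff₀ (by positivity) (by positivity)]
  have : (0 : ℝ) < n + x := by positivity
  nlinarith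

theorem summable_one_div_sq_nat_add_one_add {x : ℝ} (hx : 0 < x) :
    Summable fun n : ℕ => 1 / ((n : ℝ) + 1 + x) ^ 2 :=
  .of_nonneg_of_le (fun _ => by positivity) (one_div_sq_nat_add_one_add_le hx)
    (hasSum_one_div_sub_one_div_nat_add hx).summable

theorem tsum_one_div_sq_nat_add_one_add_le {x : ℝ} (hx : 0 < x) :
    ∑' n : ℕ, 1 / ((n : ℝ) + 1 + x) ^ 2 ≤ 1 / x := by
  rw [← (hasSum_one_div_sub_one_div_nat_add hx).tsum_eq]
  exact (summable_one_div_sq_nat_add_one_add hx).tsum_le_tsum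
    (one_div_sq_nat_add_one_add_le hx) (hasSum_one_div_sub_one_div_nat_add hx).summable

theorem one_div_sub_one_div_sq_le_tsum {x : ℝ} (hx : 0 < x) :
    1 / x - 1 / x ^ 2 ≤ ∑' n : ℕ, 1 / ((n : ℝ) + 1 + x) ^ 2 := by
  have hx1 : 0 < 1 + x := by positivity
  have htel := hasSum_one_div_sub_one_div_nat_add hx1
  have hle : 1 / (1 + x) ≤ ∑' n : ℕ, 1 / ((n : ℝ) + 1 + x) ^ 2 := by
    rw [← htel.tsum_eq]
    refine htel.summable.tsum_le_tsum (fun n => ?_) (summable_one_div_sq_nat_add_one_add hx)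
    rw [div_sub_div _ _ (by positivity) (by positivity),
      div_le_div_iff₀ (by positivity) (by positivity)]
    have : (0 : ℝ) < n + x := by positivity
    nlinarith
  refine le_trans ?_ hle
  rw [div_sub_div _ _ (by positivity) (by positivity),
    div_le_div_iff₀ (by positivity) (by positivity)]
  nlinarith

theorem beurlingB_sub_one (x : ℝ) :
    beurlingB x - 1 = 2 * (sin (π * x) / π) ^ 2 *
      (1 / x - ∑' n : ℕ, 1 / ((n : ℝ) + 1 + x) ^ 2) := by
  rw [beurlingB]; ring

theorem beurlingB_neg_add_one {x : ℝ} (hxZ : ∀ n : ℤ, x ≠ n) :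
    beurlingB (-x) + 1 = 2 * (sin (π * x) / π) ^ 2 *
      (∑' n : ℕ, 1 / ((n : ℝ) + 1 + x) ^ 2 + 1 / x ^ 2 - 1 / x) := by
  have hsum := hasSum_sq_sin_pi_mul_div_add_int hxZ
  have hS : Summable fun n : ℕ => (sin (π * x) / π) ^ 2 / (x + (n : ℤ)) ^ 2 :=
    hsum.summable.comp_injective (i := fun n : ℕ => (n : ℤ)) Nat.cast_injective
  have hS' : Summable fun n : ℕ => (sin (π * x) / π) ^ 2 / (x + (-(n + 1) : ℤ)) ^ 2 :=
    hsum.summable.comp_injective (i := fun n : ℕ => -((n : ℤ) + 1)) fun a b h => by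
      simpa using h
  have hsplit := tsum_of_nat_of_neg_add_one
    (f := fun n : ℤ => (sin (π * x) / π) ^ 2 / (x + n) ^ 2) hS hS'
  rw [hsum.tsum_eq, hS.tsum_eq_zero_add] at hsplit
  have hpos : ∑' n : ℕ, (sin (π * x) / π) ^ 2 / (x + ((n + 1 : ℕ) : ℤ)) ^ 2 =
      (sin (π * x) / π) ^ 2 * ∑' n : ℕ, 1 / ((n : ℝ) + 1 + x) ^ 2 := by
    rw [← tsum_mul_left]
    refine tsum_congr fun n => ?_
    push_cast
    ring
  have hneg : ∑' n : ℕ, (sin (π * x) / π) ^ 2 / (x + (-(n + 1) : ℤ)) ^ 2 =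
      (sin (π * x) / π) ^ 2 * ∑' n : ℕ, 1 / ((n : ℝ) + 1 + -x) ^ 2 := by
    rw [← tsum_mul_left]
    refine tsum_congr fun n => ?_
    push_cast
    rw [show (x + -((n : ℝ) + 1)) ^ 2 = ((n : ℝ) + 1 + -x) ^ 2 by ring, mul_one_div]
  rw [hpos, hneg] at hsplit
  rw [beurlingB, mul_neg, sin_neg, neg_div, neg_sq, one_div_neg_eq_neg_one_div]
  simp only [Nat.cast_zero, Int.cast_zero, add_zero] at hsplit
  linear_combination 2 * hsplit

theorem ae_forall_ne_intCast : ∀ᵐ x : ℝ, ∀ n : ℤ, x ≠ n := by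
  filter_upwards [(Set.countable_range ((↑) : ℤ → ℝ)).ae_notMem volume] with x hx n h
  exact hx ⟨n, h.symm⟩

theorem beurlingB_sub_sign_add_neg {x : ℝ} (hxZ : ∀ n : ℤ, x ≠ n) :
    (beurlingB x - Real.sign x) + (beurlingB (-x) - Real.sign (-x)) =
      2 * ((sin (π * x) / π) ^ 2 / x ^ 2) := by
  have key {y : ℝ} (hy : 0 < y) (hyZ : ∀ n : ℤ, y ≠ n) :
      (beurlingB y - Real.sign y) + (beurlingB (-y) - Real.sign (-y)) =
        2 * ((sin (π * y) / π) ^ 2 / y ^ 2) := by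
    rw [Real.sign_neg, Real.sign_of_pos hy, sub_neg_eq_add, beurlingB_sub_one,
      beurlingB_neg_add_one hyZ]
    ring
  rcases lt_or_gt_of_ne (show x ≠ 0 by exact_mod_cast hxZ 0) with h | h
  · have := key (neg_pos.2 h) fun n hn => hxZ (-n) (by push_cast; linarith)
    rwa [neg_neg, mul_neg, sin_neg, neg_div, neg_sq, neg_sq, add_comm] at this
  · exact key h hxZ

theorem abs_beurlingB_sub_sign_le {x : ℝ} (hxZ : ∀ n : ℤ, x ≠ n) :
    |beurlingB x - Real.sign x| ≤ 2 * ((sin (π * x) / π) ^ 2 / x ^ 2) := by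
  have key {y a : ℝ} (h0 : 0 ≤ a) (h1 : a ≤ 1 / y ^ 2) :
      |2 * (sin (π * y) / π) ^ 2 * a| ≤ 2 * ((sin (π * y) / π) ^ 2 / y ^ 2) := by
    rw [abs_of_nonneg (by positivity), mul_assoc, div_eq_mul_one_div ((sin (π * y) / π) ^ 2)]
    gcongr
  rcases lt_or_gt_of_ne (show x ≠ 0 by exact_mod_cast hxZ 0) with h | h
  · obtain ⟨y, rfl⟩ : ∃ y, x = -y := ⟨-x, by ring⟩
    have hy : 0 < y := by linarith
    rw [Real.sign_of_neg h, sub_neg_eq_add, beurlingB_neg_add_one fun n hn =>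
      hxZ (-n) (by push_cast; linarith), mul_neg, sin_neg, neg_div, neg_sq, neg_sq]
    exact key (by linarith [one_div_sub_one_div_sq_le_tsum hy])
      (by linarith [tsum_one_div_sq_nat_add_one_add_le hy])
  · rw [Real.sign_of_pos h, beurlingB_sub_one]
    exact key (by linarith [tsum_one_div_sq_nat_add_one_add_le h])
      (by linarith [one_div_sub_one_div_sq_le_tsum h])

theorem integrable_sq_sin_pi_mul_div :
    Integrable fun x : ℝ => (sin (π * x) / π) ^ 2 / x ^ 2 := by
  refine (integrable_inv_one_add_sq.const_mul 2).mono'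
    (by fun_prop : Measurable _).aestronglyMeasurable (.of_forall fun x => ?_)
  rw [Real.norm_of_nonneg (by positivity)]
  rcases eq_or_ne x 0 with rfl | hx
  · simp
  have h1 : (sin (π * x) / π) ^ 2 ≤ x ^ 2 := by
    rw [sq_le_sq, abs_div, abs_of_pos pi_pos, div_le_iff₀ pi_pos]
    simpa [abs_mul, abs_of_pos pi_pos, mul_comm] using abs_sin_le_abs (x := π * x)
  have h2 : (sin (π * x) / π) ^ 2 ≤ 1 := by
    rw [sq_le_one_iff_abs_le_one, abs_div, abs_of_pos pi_pos, div_le_one pi_pos]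
    linarith [abs_sin_le_one (π * x), pi_gt_three]
  rw [← div_eq_mul_inv, div_le_div_iff₀ (by positivity) (by positivity)]
  nlinarith [sq_nonneg x]

theorem integral_sq_sin_pi_mul_div :
    ∫ x : ℝ, (sin (π * x) / π) ^ 2 / x ^ 2 = 1 := by
  have hsum := integrable_sq_sin_pi_mul_div.hasSum_intervalIntegral_comp_add_int
  have hshift (n : ℤ) (x : ℝ) : (sin (π * (x + n)) / π) ^ 2 = (sin (π * x) / π) ^ 2 := by
    rw [mul_add, mul_comm π (n : ℝ), sin_add_int_mul_pi, div_pow, mul_pow, ← zpow_natCast,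
      ← zpow_mul, mul_comm n, zpow_mul]
    norm_num [div_pow]
  simp only [hshift, intervalIntegral.integral_of_le zero_le_one] at hsum
  have hint (n : ℤ) : Integrable (fun x : ℝ => (sin (π * x) / π) ^ 2 / (x + n) ^ 2)
      (volume.restrict (Set.Ioc 0 1)) := by
    have := (integrable_sq_sin_pi_mul_div.comp_add_right (n : ℝ)).integrableOn
      (s := Set.Ioc 0 1)
    simp only [hshift] at this
    exact this
  have hswap := hasSum_integral_of_summable_integral_norm hint <| by
    simpa only [norm_div, norm_pow, Real.norm_eq_abs, sq_abs, div_pow] using hsum.summable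
  rw [hsum.unique hswap]
  have hone : (fun x : ℝ => ∑' n : ℤ, (sin (π * x) / π) ^ 2 / (x + n) ^ 2)
      =ᵐ[volume.restrict (Set.Ioc 0 1)] fun _ => 1 := by
    filter_upwards [ae_restrict_of_ae ae_forall_ne_intCast] with x hx
    exact (hasSum_sq_sin_pi_mul_div_add_int hx).tsum_eq
  rw [integral_congr_ae hone]
  simp

theorem measurable_beurlingB : Measurable beurlingB := by
  have : Measurable fun x : ℝ => ∑' n : ℕ, 1 / (((n : ℝ) + 1) + x) ^ 2 :=
    .tsum fun n => by fun_prop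
  unfold beurlingB
  fun_prop

theorem measurable_real_sign : Measurable Real.sign :=
  .ite measurableSet_Iio measurable_const (.ite measurableSet_Ioi measurable_const measurable_const)

theorem integrable_beurlingB_sub_sign : Integrable fun x => beurlingB x - Real.sign x := by
  refine (integrable_sq_sin_pi_mul_div.const_mul 2).mono'
    (measurable_beurlingB.sub measurable_real_sign).aestronglyMeasurable ?_
  filter_upwards [ae_forall_ne_intCast] with x hx using abs_beurlingB_sub_sign_le hx

theorem integral_beurlingB_sub_sign : ∫ x, (beurlingB x - Real.sign x) = 1 := by
  have hint := integrable_beurlingB_sub_sign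
  have hneg := integral_neg_eq_self (fun x => beurlingB x - Real.sign x) volume
  have hadd := integral_add hint hint.comp_neg
  have hae : (fun x => (beurlingB x - Real.sign x) + (beurlingB (-x) - Real.sign (-x)))
      =ᵐ[volume] fun x => 2 * ((sin (π * x) / π) ^ 2 / x ^ 2) := by
    filter_upwards [ae_forall_ne_intCast] with x hx using beurlingB_sub_sign_add_neg hx
  rw [integral_congr_ae hae, integral_const_mul, integral_sq_sin_pi_mul_div, hneg] at hadd
  linarith

/-- the function `x ↦ B(x) − sgn(x)` (defined for real `x` not a
nonpositive integer, and extended by its limiting values at the nonpositive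
integers) is integrable on `ℝ` with `∫_{−∞}^∞ (B(x) − sgn(x)) dx = 1`. -/
theorem beurling_minus_sgn_integral_eq_one :
    ∃ g : ℝ → ℝ,
      (∀ x : ℝ, (¬ ∃ m : ℕ, x = -(m : ℝ)) → g x = beurlingB x - Real.sign x) ∧
      Integrable g ∧ ∫ x : ℝ, g x = 1 := by
  exact ⟨fun x => beurlingB x - Real.sign x, fun _ _ => rfl, integrable_beurlingB_sub_sign,
    integral_beurlingB_sub_sign⟩
end

section
/- The series defining the Beurling function extends to an entire function: there exists an entire function F : ℂ → ℂ such that F(z) = 1 + 2 (sin(πz)/π)^2 ( 1/z − Σ_{n=1}^∞ 1/(n+z)^2 ) for every complex z that is not a nonpositive integer; in other words, the singularities of the Beurling function at 0, −1, −2, … are removable. -/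
open Real

/-- The complex Beurling function
`B(z) = 1 + 2 (sin(πz)/π)^2 (1/z − Σ_{n=1}^∞ 1/(n+z)^2)`,
given by this formula whenever `z` is not a nonpositive integer. -/
noncomputable def beurlingC (z : ℂ) : ℂ :=
  1 + 2 * (Complex.sin (Real.pi * z) / Real.pi) ^ 2 *
    (1 / z - ∑' n : ℕ, 1 / (((n : ℂ) + 1) + z) ^ 2)

lemma differentiable_dslope {f : ℂ → ℂ} (hf : Differentiable ℂ f) (a : ℂ) :
    Differentiable ℂ (dslope f a) :=
  differentiableOn_univ.1 <| (Complex.differentiableOn_dslope Filter.univ_mem).2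
    hf.differentiableOn

lemma dslope_eq_div_of_eq_zero {f : ℂ → ℂ} {a z : ℂ} (ha : f a = 0) (hz : z ≠ a) :
    dslope f a z = f z / (z - a) := by
  rw [dslope_of_ne _ hz, slope_def_field, ha, sub_zero]

/-- If `f` is entire and vanishes at the negative integers, then so is the sum of the squares of
its difference quotients at the negative integers. -/
lemma differentiable_tsum_dslope_sq {f : ℂ → ℂ} (hf : Differentiable ℂ f)
    (h0 : ∀ n : ℕ, f (-((n : ℂ) + 1)) = 0) :
    Differentiable ℂ fun z ↦ ∑' n : ℕ, dslope f (-((n : ℂ) + 1)) z ^ 2 := by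
  intro z₀
  obtain ⟨N, hN⟩ := exists_nat_gt ‖z₀‖
  obtain ⟨M, hM⟩ := (isCompact_closedBall (0 : ℂ) (N : ℝ)).exists_bound_of_continuousOn
    hf.continuous.continuousOn
  have hu : Summable fun n : ℕ ↦ M ^ 2 * (1 / ((n : ℝ) + 1) ^ 2) := by
    have := (summable_nat_add_iff 1).2 (Real.summable_one_div_nat_pow.2 one_lt_two)
    push_cast at this
    exact this.mul_left _
  have hbound (n : ℕ) (z : ℂ) (hz : z ∈ Metric.ball (0 : ℂ) N) :
      ‖dslope f (-(((n + N : ℕ) : ℂ) + 1)) z ^ 2‖ ≤ M ^ 2 * (1 / ((n : ℝ) + 1) ^ 2) := by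
    have hlow : (n : ℝ) + 1 ≤ ‖z - -(((n + N : ℕ) : ℂ) + 1)‖ := by
      have h1 := norm_sub_le (z - -(((n + N : ℕ) : ℂ) + 1)) z
      have h2 : ‖z - -(((n + N : ℕ) : ℂ) + 1) - z‖ = n + N + 1 := by
        rw [show z - -(((n + N : ℕ) : ℂ) + 1) - z = ((n + N + 1 : ℕ) : ℂ) by push_cast; ring,
          Complex.norm_natCast]
        push_cast
        ring
      rw [mem_ball_zero_iff] at hz
      linarith
    have hpos : (0 : ℝ) < (n : ℝ) + 1 := by positivity
    have hne : z ≠ -(((n + N : ℕ) : ℂ) + 1) :=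
      sub_ne_zero.1 (norm_pos_iff.1 (hpos.trans_le hlow))
    have hMz := hM z (Metric.ball_subset_closedBall hz)
    rw [dslope_eq_div_of_eq_zero (h0 _) hne, norm_pow, norm_div, div_pow, mul_one_div]
    gcongr
  have htail : DifferentiableOn ℂ
      (fun z ↦ ∑' n : ℕ, dslope f (-(((n + N : ℕ) : ℂ) + 1)) z ^ 2) (Metric.ball 0 N) :=
    Complex.differentiableOn_tsum_of_summable_norm hu
      (fun n ↦ ((differentiable_dslope hf _).pow 2).differentiableOn) Metric.isOpen_ball hbound
  have hmem : Metric.ball (0 : ℂ) N ∈ nhds z₀ :=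
    Metric.isOpen_ball.mem_nhds (mem_ball_zero_iff.2 hN)
  have hhead : Differentiable ℂ fun z ↦
      ∑ n ∈ Finset.range N, dslope f (-((n : ℂ) + 1)) z ^ 2 :=
    Differentiable.fun_sum fun n _ ↦ (differentiable_dslope hf _).pow 2
  refine ((hhead z₀).add (htail.differentiableAt hmem)).congr_of_eventuallyEq ?_
  filter_upwards [hmem] with z hz
  exact (((summable_nat_add_iff N).1
    (Summable.of_norm_bounded hu fun n ↦ hbound n z hz)).sum_add_tsum_nat_add N).symm

lemma sin_pi_mul_neg_natCast (n : ℕ) : Complex.sin (Real.pi * -(n : ℂ)) = 0 := by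
  rw [mul_neg, Complex.sin_neg, mul_comm, Complex.sin_nat_mul_pi, neg_zero]

/-- the series defining the Beurling function extends to an entire
function; i.e. there is an entire `F : ℂ → ℂ` agreeing with the formula at every
complex `z` that is not a nonpositive integer (the singularities at
`0, −1, −2, …` are removable). -/
theorem beurling_extends_entire :
    ∃ F : ℂ → ℂ, Differentiable ℂ F ∧
      ∀ z : ℂ, (¬ ∃ m : ℕ, z = -(m : ℂ)) → F z = beurlingC z := by
  set f : ℂ → ℂ := fun z ↦ Complex.sin (Real.pi * z) with hf_def
  have hf : Differentiable ℂ f := by fun_prop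
  have hf0 : f 0 = 0 := by simp [hf_def]
  have hf1 (n : ℕ) : f (-((n : ℂ) + 1)) = 0 := by
    simpa using sin_pi_mul_neg_natCast (n + 1)
  refine ⟨fun z ↦ 1 + 2 / (Real.pi : ℂ) ^ 2 *
    (f z * dslope f 0 z - ∑' n : ℕ, dslope f (-((n : ℂ) + 1)) z ^ 2), ?_, fun z hz ↦ ?_⟩
  · exact (((hf.mul (differentiable_dslope hf 0)).sub
      (differentiable_tsum_dslope_sq hf hf1)).const_mul _).const_add _
  · have hz0 : z ≠ 0 := fun h ↦ hz ⟨0, by simpa using h⟩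
    have hterm (n : ℕ) :
        dslope f (-((n : ℂ) + 1)) z ^ 2 = f z ^ 2 * (1 / (((n : ℂ) + 1) + z) ^ 2) := by
      have hne : z ≠ -((n : ℂ) + 1) := fun h ↦ hz ⟨n + 1, by simpa using h⟩
      rw [dslope_eq_div_of_eq_zero (hf1 n) hne, div_pow, mul_one_div, sub_neg_eq_add, add_comm z]
    simp only [hterm, tsum_mul_left, dslope_eq_div_of_eq_zero hf0 hz0, sub_zero]
    change _ = 1 + 2 * (f z / Real.pi) ^ 2 * _
    ring
end
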